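/- The spectrum of the Gram matrix of the N-qubit tensorhedron MIC (the N-fold tensor product of a qubit SIC) consists exactly of the values 2^{-N}·3^{-m} for m = 0,...,N, the eigenvalue 2^{-N}3^{-m} occurring with multiplicity C(N,m)·3^m. -/

import Mathlib

open Matrix BigOperators

/-- The Gram matrix of a single-qubit SIC: `(2δ_ij + 1)/12`. -/
noncomputable def gramSIC : Matrix (Fin 4) (Fin 4) ℝ :=
  Matrix.of fun i j => (2 * (if i = j then 1 else 0) + 1) / 12

/-- The Gram matrix of the `N`-qubit tensorhedron MIC: the `N`-fold tensor
(Kronecker) product of `gramSIC`, indexed by `Fin N → Fin 4`. -/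
noncomputable def tensorhedronGram (N : ℕ) :
    Matrix (Fin N → Fin 4) (Fin N → Fin 4) ℝ :=
  Matrix.of fun f g => ∏ k, gramSIC (f k) (g k)

noncomputable def tpow (N : ℕ) (A : Matrix (Fin 4) (Fin 4) ℝ) :
    Matrix (Fin N → Fin 4) (Fin N → Fin 4) ℝ :=
  Matrix.of fun f g => ∏ k, A (f k) (g k)

theorem tpow_mul (N : ℕ) (A B : Matrix (Fin 4) (Fin 4) ℝ) :
    tpow N (A * B) = tpow N A * tpow N B := by
  ext f g
  simp only [tpow, Matrix.mul_apply, Matrix.of_apply, Finset.prod_univ_sum,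
    Fintype.piFinset_univ, Finset.prod_mul_distrib]

theorem tpow_diagonal (N : ℕ) (d : Fin 4 → ℝ) :
    tpow N (Matrix.diagonal d) = Matrix.diagonal fun f => ∏ k, d (f k) := by
  ext f g
  by_cases h : f = g
  · subst h
    simp [tpow]
  · obtain ⟨k, hk⟩ := Function.ne_iff.mp h
    rw [Matrix.diagonal_apply_ne _ h]
    simp only [tpow, Matrix.of_apply]
    exact Finset.prod_eq_zero (Finset.mem_univ k) (Matrix.diagonal_apply_ne _ hk)

noncomputable def had : Matrix (Fin 4) (Fin 4) ℝ :=
  !![1,1,1,1;1,-1,1,-1;1,1,-1,-1;1,-1,-1,1]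

noncomputable def dvec (i : Fin 4) : ℝ := 1 / 2 * (if i = 0 then 1 else 1 / 3)

theorem had_inv : had * ((1 / 4 : ℝ) • had) = Matrix.diagonal fun _ => 1 := by
  ext i j
  fin_cases i <;> fin_cases j <;>
    simp [had, Matrix.mul_apply, Fin.sum_univ_four] <;> norm_num

theorem had_conj : gramSIC = had * Matrix.diagonal dvec * ((1 / 4 : ℝ) • had) := by
  ext i j
  rw [Matrix.mul_apply]
  simp only [Matrix.mul_diagonal]
  fin_cases i <;> fin_cases j <;>
    simp [had, gramSIC, dvec, Fin.sum_univ_four] <;> norm_num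

theorem gram_charpoly (N : ℕ) :
    (tensorhedronGram N).charpoly =
      (Matrix.diagonal fun f : Fin N → Fin 4 => ∏ k, dvec (f k)).charpoly := by
  have h1 : tpow N had * tpow N ((1 / 4 : ℝ) • had) = 1 := by
    rw [← tpow_mul, had_inv, tpow_diagonal]
    simp
  have h2 : tpow N ((1 / 4 : ℝ) • had) * tpow N had = 1 := mul_eq_one_comm.mp h1
  have h3 : tensorhedronGram N = tpow N had *
      (Matrix.diagonal fun f : Fin N → Fin 4 => ∏ k, dvec (f k)) *
        tpow N ((1 / 4 : ℝ) • had) := by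
    rw [← tpow_diagonal, ← tpow_mul, ← tpow_mul, ← had_conj]
    rfl
  rw [h3, Matrix.charpoly_mul_comm, ← Matrix.mul_assoc, h2, Matrix.one_mul]

def wt {N : ℕ} (f : Fin N → Fin 4) : ℕ := (Finset.univ.filter fun k => f k ≠ 0).card

theorem prod_dvec {N : ℕ} (f : Fin N → Fin 4) :
    ∏ k, dvec (f k) = 1 / 2 ^ N * (1 / 3 ^ wt f) := by
  simp only [dvec, Finset.prod_mul_distrib, Finset.prod_ite, wt]
  simp

theorem card_wt (N m : ℕ) :
    (Finset.univ.filter fun f : Fin N → Fin 4 => wt f = m).card = N.choose m * 3 ^ m := by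
  have h : (∑ f : Fin N → Fin 4, (Polynomial.X : Polynomial ℕ) ^ wt f)
      = (1 + Polynomial.C 3 * Polynomial.X) ^ N := by
    have : (1 + Polynomial.C 3 * Polynomial.X : Polynomial ℕ) =
        ∑ i : Fin 4, if i = 0 then 1 else Polynomial.X := by
      simp [Fin.sum_univ_four]
      ring
    rw [this, ← Fin.prod_const, Finset.prod_univ_sum, Fintype.piFinset_univ]
    refine Finset.sum_congr rfl fun f _ => ?_
    simp [Finset.prod_ite, wt]
  have h' := congrArg (fun p => Polynomial.coeff p m) h
  have e : ((1 + Polynomial.C 3 * Polynomial.X : Polynomial ℕ)) ^ N =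
      ((1 + Polynomial.X : Polynomial ℕ) ^ N).comp (Polynomial.C 3 * Polynomial.X) := by
    simp
  simp only [e, Polynomial.comp_C_mul_X_coeff, Polynomial.coeff_one_add_X_pow,
    Polynomial.finsetSum_coeff, Polynomial.coeff_X_pow] at h'
  rw [Finset.card_filter]
  simpa [eq_comm] using h'

theorem eig_multiset (N : ℕ) (hH : (tensorhedronGram N).IsHermitian) :
    Multiset.map hH.eigenvalues Finset.univ.val =
      Multiset.map (fun f : Fin N → Fin 4 => (1 / 2 ^ N * (1 / 3 ^ wt f) : ℝ))
        Finset.univ.val := by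
  have h := hH.roots_charpoly_eq_eigenvalues
  rw [gram_charpoly, Matrix.charpoly_diagonal, Polynomial.roots_prod _ _
    (Finset.prod_ne_zero_iff.mpr fun _ _ => Polynomial.X_sub_C_ne_zero _)] at h
  simp only [prod_dvec, Polynomial.roots_X_sub_C, Multiset.bind_singleton] at h
  exact h.symm

/-- the spectrum of the Gram matrix of the `N`-qubit tensorhedron
MIC consists exactly of the values `2⁻ᴺ 3⁻ᵐ` for `m = 0,…,N`, with the
eigenvalue `2⁻ᴺ 3⁻ᵐ` occurring with multiplicity `C(N,m)·3ᵐ`. -/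
theorem stmt17 (N : ℕ) (hH : (tensorhedronGram N).IsHermitian) :
    (∀ x, ∃ m ≤ N, hH.eigenvalues x = 1 / 2 ^ N * (1 / 3 ^ m)) ∧
      (∀ m ≤ N,
        (Finset.univ.filter
          (fun x => hH.eigenvalues x = 1 / 2 ^ N * (1 / 3 ^ m))).card
          = Nat.choose N m * 3 ^ m) := by
  have key := eig_multiset N hH
  constructor
  · intro x
    have hx : hH.eigenvalues x ∈ Multiset.map hH.eigenvalues Finset.univ.val :=
      Multiset.mem_map_of_mem _ (Finset.mem_univ x)
    rw [key] at hx
    obtain ⟨f, -, hf⟩ := Multiset.mem_map.mp hx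
    refine ⟨wt f, ?_, hf.symm⟩
    exact (Finset.card_le_univ _).trans (by simp)
  · intro m _
    have hc := congrArg (Multiset.count ((1 / 2 ^ N * (1 / 3 ^ m) : ℝ))) key
    rw [Multiset.count_map, Multiset.count_map] at hc
    rw [← card_wt N m]
    have e1 : ∀ f : Fin N → Fin 4,
        ((1 / 2 ^ N * (1 / 3 ^ m) : ℝ) = 1 / 2 ^ N * (1 / 3 ^ wt f)) ↔ wt f = m := by
      intro f
      constructor
      · intro h
        have h2 := mul_left_cancel₀ (by positivity) h
        simp only [one_div, _root_.inv_inj] at h2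
        exact (pow_right_injective₀ (by norm_num : (0:ℝ) < 3) (by norm_num) h2).symm
      · rintro rfl
        rfl
    simp only [e1, eq_comm (a := (1 / 2 ^ N * (1 / 3 ^ m) : ℝ))
      (b := hH.eigenvalues _)] at hc
    simp only [Finset.card, Finset.filter_val]
    convert hc
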